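/- Among all trees with n vertices and exactly k leaves (2 ≤ k ≤ n-1), a tree maximizes the largest Laplacian eigenvalue if and only if it is a 'spider' consisting of a center vertex with k paths attached whose lengths pairwise differ by at most one. -/

import Mathlib

open SimpleGraph Finset Matrix

/-- The degree of vertex `v`: the number of its neighbors. -/
noncomputable def gdeg {V : Type*} (G : SimpleGraph V) (v : V) : ℕ :=
  (G.neighborSet v).ncard

open scoped Classical in
/-- The Laplacian matrix `L = D - A` of a graph, with real entries. -/
noncomputable def lap {V : Type*} [Fintype V] [DecidableEq V] (G : SimpleGraph V) :
    Matrix V V ℝ :=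
  Matrix.of fun u v =>
    (if u = v then (gdeg G u : ℝ) else 0) - (if G.Adj u v then 1 else 0)

/-- `lam` is the largest Laplacian eigenvalue of `G`. -/
def IsMaxEig {V : Type*} [Fintype V] [DecidableEq V] (G : SimpleGraph V) (lam : ℝ) : Prop :=
  IsGreatest {μ : ℝ | ∃ f : V → ℝ, f ≠ 0 ∧ (lap G).mulVec f = μ • f} lam

namespace Sp

set_option linter.unusedSectionVars false

variable {V : Type*} [Fintype V] [DecidableEq V]

structure RT (T : SimpleGraph V) (c : V) (p : V → V) (d : V → ℕ) : Prop where
  d0 : d c = 0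
  dp : ∀ u, u ≠ c → d (p u) + 1 = d u
  adj : ∀ u v, T.Adj u v ↔ (u ≠ c ∧ p u = v) ∨ (v ≠ c ∧ p v = u)

def ch (c : V) (p : V → V) (u : V) : Finset V := univ.filter fun w => w ≠ c ∧ p w = u

lemma mem_ch {c : V} {p : V → V} {u w : V} : w ∈ ch c p u ↔ w ≠ c ∧ p w = u := by
  simp [ch]

/-- neighbour sum -/
noncomputable def ns (c : V) (p : V → V) (f : V → ℝ) (u : V) : ℝ :=
  (if u = c then 0 else f (p u)) + ∑ w ∈ ch c p u, f w

lemma sum_ch {M : Type*} [AddCommMonoid M] (c : V) (p : V → V) (F : V → M) :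
    ∑ u, ∑ w ∈ ch c p u, F w = ∑ w ∈ univ.erase c, F w := by
  have := Finset.sum_fiberwise (univ.erase c) p F
  rw [← this]
  refine Finset.sum_congr rfl fun u _ => Finset.sum_congr ?_ fun _ _ => rfl
  ext w; simp [ch]

variable {T : SimpleGraph V} {c : V} {p : V → V} {d : V → ℕ}

lemma RT.notin (h : RT T c p d) {u : V} (hu : u ≠ c) : p u ∉ ch c p u := by
  intro hm
  obtain ⟨h1, h2⟩ := mem_ch.1 hm
  have := h.dp u hu
  have := h.dp _ h1
  rw [h2] at this
  omega

lemma RT.nbr (h : RT T c p d) (u : V) :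
    T.neighborSet u = ((if u = c then ∅ else {p u}) ∪ ch c p u : Finset V) := by
  ext w
  by_cases hu : u = c
  · simp [h.adj, hu, mem_ch]
  · simp [h.adj, hu, mem_ch, eq_comm]

lemma RT.gd (h : RT T c p d) (u : V) :
    gdeg T u = (if u = c then 0 else 1) + (ch c p u).card := by
  unfold gdeg
  rw [h.nbr, Set.ncard_coe_finset]
  split_ifs with hu
  · simp
  · rw [Finset.card_union_of_disjoint (by simpa using h.notin hu)]; simp

lemma RT.mulVec (h : RT T c p d) (f : V → ℝ) (u : V) :
    (lap T).mulVec f u = gdeg T u * f u - ns c p f u := by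
  classical
  have : (lap T).mulVec f u = gdeg T u * f u - ∑ w, if T.Adj u w then f w else 0 := by
    simp only [Matrix.mulVec, dotProduct, lap, Matrix.of_apply, sub_mul, Finset.sum_sub_distrib]
    simp
  rw [this, ← Finset.sum_filter]
  congr 1
  have h2 : (univ.filter fun w => T.Adj u w) = ((if u = c then ∅ else {p u}) ∪ ch c p u) := by
    ext w
    have := h.nbr u
    have h3 : w ∈ T.neighborSet u ↔ w ∈ (((if u = c then ∅ else {p u}) ∪ ch c p u : Finset V) : Set V) := by
      rw [this]
    simpa using h3
  rw [h2, ns]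
  split_ifs with hu
  · simp
  · rw [Finset.sum_union (by simpa using h.notin hu)]; simp

lemma RT.dpos (h : RT T c p d) {u : V} (hu : u ≠ c) : 0 < d u := by
  have := h.dp u hu; omega

lemma RT.ind (h : RT T c p d) {P : V → Prop} (hc : P c) (hs : ∀ u, u ≠ c → P (p u) → P u) :
    ∀ u, P u := by
  have : ∀ m u, d u = m → P u := by
    intro m
    induction m with
    | zero =>
      intro u hu
      by_cases huc : u = c
      · rwa [huc]
      · have := h.dpos huc; omega
    | succ m ih =>
      intro u hu
      by_cases huc : u = c
      · rwa [huc]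
      · exact hs u huc (ih _ (by have := h.dp u huc; omega))
  exact fun u => this _ u rfl

noncomputable def wt (p : V → V) (d : V → ℕ) (r : V → ℝ) (u : V) : ℝ :=
  ∏ j ∈ range (d u), r (p^[j] u)

lemma RT.wtc (h : RT T c p d) (r : V → ℝ) : wt p d r c = 1 := by simp [wt, h.d0]

lemma RT.wts (h : RT T c p d) (r : V → ℝ) {u : V} (hu : u ≠ c) :
    wt p d r u = r u * wt p d r (p u) := by
  unfold wt
  rw [← h.dp u hu, Finset.prod_range_succ']
  simp [mul_comm]

noncomputable def E (T : SimpleGraph V) (c : V) (p : V → V) (r : V → ℝ) (u : V) : ℝ :=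
  gdeg T u + (if u = c then 0 else (r u)⁻¹) + ∑ w ∈ ch c p u, r w

lemma RT.ch_sum (h : RT T c p d) (r : V → ℝ) (u : V) :
    ∑ w ∈ ch c p u, wt p d r w = wt p d r u * ∑ w ∈ ch c p u, r w := by
  rw [Finset.mul_sum]
  refine Finset.sum_congr rfl fun w hw => ?_
  obtain ⟨h1, h2⟩ := mem_ch.1 hw
  rw [h.wts r h1, h2, mul_comm]

lemma RT.upper (h : RT T c p d) (r : V → ℝ) (hr : ∀ u, 0 < r u) (μ ν : ℝ)
    (hE : ∀ u, E T c p r u ≤ μ) (f : V → ℝ) (hf : f ≠ 0)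
    (hν : (lap T).mulVec f = ν • f) : ν ≤ μ ∧ (ν = μ → ∀ u, E T c p r u = μ) := by
  set x := wt p d r with hx
  have xpos : ∀ u, 0 < x u := fun u => Finset.prod_pos fun _ _ => hr _
  obtain ⟨u0, -, hu0⟩ := Finset.exists_max_image univ (fun u => |f u| / x u) ⟨c, mem_univ _⟩
  set M := |f u0| / x u0 with hM
  have hle : ∀ u, |f u| ≤ M * x u := fun u => by
    have := hu0 u (mem_univ _)
    rwa [div_le_iff₀ (xpos u)] at this
  have hM0 : |f u0| = M * x u0 := by rw [hM, div_mul_cancel₀ _ (xpos u0).ne']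
  have Mpos : 0 < M := by
    by_contra hn
    apply hf
    funext u
    have h1 := hle u
    have h2 : M * x u ≤ 0 := mul_nonpos_of_nonpos_of_nonneg (not_lt.1 hn) (xpos u).le
    exact abs_eq_zero.1 (le_antisymm (h1.trans h2) (abs_nonneg _))
  have nsx : ∀ u, gdeg T u * x u + ns c p x u = x u * E T c p r u := by
    intro u
    unfold ns E
    rw [hx, h.ch_sum]
    split_ifs with hu
    · ring
    · rw [h.wts r hu]
      have := (hr u).ne'
      field_simp
      ring
  have key : ∀ u, ν * |f u| ≤ gdeg T u * |f u| + ns c p (fun w => |f w|) u := by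
    intro u
    have h1 := congrFun hν u
    rw [h.mulVec] at h1
    simp only [Pi.smul_apply, smul_eq_mul] at h1
    have h2 : ν * |f u| ≤ |ν * f u| := by
      rw [abs_mul]; exact mul_le_mul_of_nonneg_right (le_abs_self _) (abs_nonneg _)
    rw [← h1] at h2
    refine h2.trans ((abs_sub _ _).trans ?_)
    refine add_le_add ?_ ?_
    · rw [abs_mul, Nat.abs_cast]
    · unfold ns
      refine (abs_add_le _ _).trans (add_le_add ?_ (Finset.abs_sum_le_sum_abs _ _))
      split_ifs <;> simp
  have nsmono : ∀ u, ns c p (fun w => |f w|) u ≤ M * ns c p x u := by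
    intro u
    unfold ns
    rw [mul_add, Finset.mul_sum]
    refine add_le_add ?_ (Finset.sum_le_sum fun w _ => hle w)
    split_ifs
    · simp
    · exact hle _
  have main : ∀ u, |f u| = M * x u → ν * (M * x u) ≤ μ * (M * x u) ∧
      (ν = μ → E T c p r u = μ ∧ M * ns c p x u ≤ ns c p (fun w => |f w|) u) := by
    intro u hu
    have h1 := key u
    rw [hu] at h1
    have h2 := nsmono u
    have h3 := nsx u
    have h4 := hE u
    have hp : 0 < M * x u := mul_pos Mpos (xpos u)
    have h5 : gdeg T u * (M * x u) + M * ns c p x u = (M * x u) * E T c p r u := by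
      rw [mul_assoc M, ← h3]; ring
    have h6 : (M * x u) * E T c p r u ≤ (M * x u) * μ := mul_le_mul_of_nonneg_left h4 hp.le
    refine ⟨by linarith, fun he => ?_⟩
    subst he
    have h7 : (M * x u) * E T c p r u = (M * x u) * ν := by linarith
    exact ⟨mul_left_cancel₀ hp.ne' h7, by linarith⟩
  refine ⟨le_of_mul_le_mul_right (main u0 hM0).1 (mul_pos Mpos (xpos u0)), fun he => ?_⟩
  have prop : ∀ u, |f u| = M * x u → (u ≠ c → |f (p u)| = M * x (p u)) ∧
      ∀ w ∈ ch c p u, |f w| = M * x w := by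
    intro u hu
    have h1 := ((main u hu).2 he).2
    unfold ns at h1
    rw [mul_add, Finset.mul_sum] at h1
    have h2 : ∑ w ∈ ch c p u, |f w| ≤ ∑ w ∈ ch c p u, M * x w :=
      Finset.sum_le_sum fun w _ => hle w
    have h3 : (if u = c then 0 else |f (p u)|) ≤ M * (if u = c then 0 else x (p u)) := by
      split_ifs
      · simp
      · exact hle _
    constructor
    · intro huc
      simp only [huc, if_false] at h1 h3
      linarith
    · exact (Finset.sum_eq_sum_iff_of_le fun w _ => hle w).1 (by linarith)
  have hc : |f c| = M * x c := by
    have : ∀ u, |f u| = M * x u → |f c| = M * x c := by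
      refine h.ind (fun h => h) fun u hu ih hh => ih ((prop u hh).1 hu)
    exact this u0 hM0
  have all : ∀ u, |f u| = M * x u := by
    refine h.ind hc fun u hu ih => (prop _ ih).2 u (mem_ch.2 ⟨hu, rfl⟩)
  exact fun u => ((main u (all u)).2 he).1

lemma lap_herm (T : SimpleGraph V) : (lap T).IsHermitian := by
  ext u v
  simp only [lap, conjTranspose_apply, Matrix.of_apply, star_trivial]
  by_cases h : u = v
  · subst h; simp
  · have h' : ¬ v = u := fun e => h e.symm
    by_cases ha : T.Adj u v
    · have hb : T.Adj v u := ha.symm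
      simp [h, h', ha, hb]
    · have hb : ¬ T.Adj v u := fun e => ha e.symm
      simp [h, h', ha, hb]

lemma rayleigh (T : SimpleGraph V) (μ : ℝ) (h : IsMaxEig T μ) (g : V → ℝ) :
    ∑ u, g u * (lap T).mulVec g u ≤ μ * ∑ u, g u * g u := by
  have hH : (μ • (1 : Matrix V V ℝ) - lap T).IsHermitian := by
    refine Matrix.IsHermitian.sub ?_ (lap_herm T)
    simp [Matrix.IsHermitian]
  have hp : (μ • (1 : Matrix V V ℝ) - lap T).PosSemidef := by
    rw [hH.posSemidef_iff_eigenvalues_nonneg]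
    intro i
    have h1 := hH.mulVec_eigenvectorBasis i
    set v : V → ℝ := (hH.eigenvectorBasis i).ofLp with hv
    have hv0 : v ≠ 0 := by
      intro h0
      have := hH.eigenvectorBasis.orthonormal.ne_zero i
      apply this
      ext j
      exact congrFun h0 j
    rw [Matrix.sub_mulVec, Matrix.smul_mulVec, Matrix.one_mulVec] at h1
    have h2 : (lap T).mulVec v = (μ - hH.eigenvalues i) • v := by
      rw [sub_smul]
      rw [sub_eq_iff_eq_add] at h1
      rw [h1]; simp
    have := h.2 ⟨v, hv0, h2⟩
    simp only [Pi.zero_apply]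
    linarith
  have := hp.dotProduct_mulVec_nonneg g
  rw [Matrix.sub_mulVec, Matrix.smul_mulVec, Matrix.one_mulVec] at this
  simp only [dotProduct, star_trivial, Pi.sub_apply, Pi.smul_apply, smul_eq_mul, mul_sub,
    Finset.sum_sub_distrib] at this
  rw [Finset.mul_sum]
  have h3 : ∑ u, μ * (g u * g u) = ∑ u, g u * (μ * g u) :=
    Finset.sum_congr rfl fun _ _ => by ring
  linarith

lemma exists_max [Nonempty V] (T : SimpleGraph V) : ∃ μ, IsMaxEig T μ := by
  have hH := lap_herm T
  obtain ⟨i, hi⟩ := Finite.exists_max hH.eigenvalues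
  refine ⟨hH.eigenvalues i, ⟨_, ?_, hH.mulVec_eigenvectorBasis i⟩, ?_⟩
  · intro h0
    have := hH.eigenvectorBasis.orthonormal.ne_zero i
    apply this
    ext j
    exact congrFun h0 j
  · rintro μ ⟨f, hf, he⟩
    have : μ ∈ spectrum ℝ (lap T) := by
      rw [← Matrix.spectrum_toLin', ← Module.End.hasEigenvalue_iff_mem_spectrum]
      exact Module.End.hasEigenvalue_of_hasEigenvector (x := f)
        (Module.End.hasEigenvector_iff.2 ⟨Module.End.mem_eigenspace_iff.2 (by simpa using he), hf⟩)
    rw [hH.spectrum_real_eq_range_eigenvalues] at this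
    obtain ⟨j, rfl⟩ := this
    exact hi j

lemma RT.lower (h : RT T c p d) (r : V → ℝ) (μ : ℝ) (hμ : IsMaxEig T μ)
    (hE : ∀ u, u ≠ c → r u ≠ 0 → μ ≤ E T c p r u) : E T c p r c ≤ μ := by
  set g := wt p d (fun u => - r u) with hg
  have nsx : ∀ u, g u * (lap T).mulVec g u = g u * g u * E T c p r u := by
    intro u
    rw [h.mulVec]
    unfold ns E
    rw [hg, h.ch_sum]
    split_ifs with hu
    · simp only [Finset.sum_neg_distrib]; ring
    · rw [h.wts _ hu, Finset.sum_neg_distrib]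
      by_cases h0 : r u = 0
      · simp [h0]
      · field_simp
        ring
  have h1 := rayleigh T μ hμ g
  by_contra hn
  push Not at hn
  have h2 : μ * ∑ u, g u * g u < ∑ u, g u * (lap T).mulVec g u := by
    rw [Finset.mul_sum]
    refine Finset.sum_lt_sum (fun u _ => ?_) ⟨c, mem_univ _, ?_⟩
    · rw [nsx, mul_comm]
      by_cases hu : u = c
      · subst hu
        exact mul_le_mul_of_nonneg_left hn.le (mul_self_nonneg _)
      · by_cases h0 : r u = 0
        · rw [hg, h.wts _ hu]; simp [h0]
        · exact mul_le_mul_of_nonneg_left (hE u hu h0) (mul_self_nonneg _)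
    · rw [nsx, hg, h.wtc]; simpa using hn
  linarith

end Sp

namespace Sp
set_option linter.unusedSectionVars false
variable {V : Type*} [Fintype V] [DecidableEq V]
variable {T : SimpleGraph V} {c : V} {p : V → V} {d : V → ℕ}

lemma par_inj (hd : ∀ u, u ≠ c → d (p u) + 1 = d u) :
    Set.InjOn (fun u => s(u, p u)) (univ.erase c : Finset V) := by
  intro u hu v hv huv
  simp at hu hv
  simp only [Sym2.eq_iff] at huv
  rcases huv with h | h
  · exact h.1
  · have h1 := hd u hu
    have h2 := hd v hv
    rw [h.2] at h1
    rw [← h.1] at h2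
    omega

lemma RT.of_tree (hT : T.IsTree) (c : V) : ∃ p, RT T c p (T.dist c) := by
  classical
  have ex : ∀ u, ∃ v, u ≠ c → T.Adj u v ∧ T.dist c v + 1 = T.dist c u := by
    intro u
    by_cases hu : u = c
    · exact ⟨u, fun h => absurd hu h⟩
    · obtain ⟨w, hw⟩ := hT.1.exists_walk_length_eq_dist u c
      cases w with
      | nil => exact absurd rfl hu
      | cons hadj w' =>
        rename_i v
        refine ⟨v, fun _ => ⟨hadj, ?_⟩⟩
        have h1 := dist_le w'
        rw [Walk.length_cons] at hw
        have h2 := hT.1.dist_triangle (u := u) (v := v) (w := c)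
        have h3 : T.dist u v = 1 := dist_eq_one_iff_adj.2 hadj
        rw [dist_comm, dist_comm (u := c)]
        omega
  choose p hp using ex
  have hd : ∀ u, u ≠ c → T.dist c (p u) + 1 = T.dist c u := fun u hu => (hp u hu).2
  refine ⟨p, by simp, hd, fun u v => ⟨fun ha => ?_, ?_⟩⟩
  · have hsub : (univ.erase c).image (fun u => s(u, p u)) ⊆ T.edgeFinset := by
      intro e he
      obtain ⟨u, hu, rfl⟩ := Finset.mem_image.1 he
      simp only [mem_edgeFinset, mem_edgeSet]
      exact (hp u (by simpa using hu)).1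
    have hcard := hT.card_edgeFinset
    have heq := Finset.eq_of_subset_of_card_le hsub (by
      rw [Finset.card_image_of_injOn (par_inj hd), Finset.card_erase_of_mem (mem_univ _),
        Finset.card_univ]
      omega)
    have : s(u, v) ∈ T.edgeFinset := by simpa using ha
    rw [← heq] at this
    obtain ⟨w, hw, he⟩ := Finset.mem_image.1 this
    have hw' : w ≠ c := by simpa using hw
    rcases Sym2.eq_iff.1 he with h | h
    · left; obtain ⟨rfl, rfl⟩ := h; exact ⟨hw', rfl⟩
    · right; obtain ⟨rfl, rfl⟩ := h; exact ⟨hw', rfl⟩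
  · rintro (⟨h, rfl⟩ | ⟨h, rfl⟩)
    · exact (hp _ h).1
    · exact (hp _ h).1.symm

lemma RT.adjp (h : RT T c p d) {u : V} (hu : u ≠ c) : T.Adj u (p u) :=
  (h.adj _ _).2 (Or.inl ⟨hu, rfl⟩)

lemma RT.isTree (h : RT T c p d) : T.IsTree := by
  classical
  have hr : ∀ u, T.Reachable c u := h.ind (Reachable.refl _) fun u hu ih =>
    ih.trans (h.adjp hu).symm.reachable
  rw [isTree_iff_connected_and_card]
  have : Nonempty V := ⟨c⟩
  refine ⟨⟨fun u v => (hr u).symm.trans (hr v)⟩, ?_⟩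
  have heq : (univ.erase c).image (fun u => s(u, p u)) = T.edgeFinset := by
    ext e
    induction e with
    | _ u v =>
    simp only [Finset.mem_image, mem_edgeFinset, mem_edgeSet, h.adj]
    constructor
    · rintro ⟨w, hw, he⟩
      have hw' : w ≠ c := by simpa using hw
      rcases Sym2.eq_iff.1 he with h | h
      · left; obtain ⟨rfl, rfl⟩ := h; exact ⟨hw', rfl⟩
      · right; obtain ⟨rfl, rfl⟩ := h; exact ⟨hw', rfl⟩
    · rintro (⟨h, rfl⟩ | ⟨h, rfl⟩)
      · exact ⟨u, by simpa using h, rfl⟩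
      · exact ⟨v, by simpa using h, Sym2.eq_swap⟩
  have hc : (T.edgeFinset).card + 1 = Fintype.card V := by
    rw [← heq, Finset.card_image_of_injOn (par_inj h.dp), Finset.card_erase_of_mem (mem_univ _),
        Finset.card_univ]
    have : 0 < Fintype.card V := Fintype.card_pos_iff.2 ⟨c⟩
    omega
  rw [Nat.card_eq_fintype_card, Nat.card_eq_fintype_card, ← hc, edgeFinset_card]

lemma RT.dist_eq (h : RT T c p d) (u : V) : T.dist c u = d u := by
  have hc := h.isTree.1
  apply le_antisymm
  · revert u
    refine h.ind (by simp) fun u hu ih => ?_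
    have h1 := hc.dist_triangle (u := c) (v := p u) (w := u)
    have h2 : T.dist (p u) u = 1 := dist_eq_one_iff_adj.2 (h.adjp hu).symm
    have := h.dp u hu
    omega
  · have : ∀ a b (w : T.Walk a b), d b ≤ d a + w.length := by
      intro a b w
      induction w with
      | nil => simp
      | cons ha w ih =>
        rw [Walk.length_cons]
        rcases (h.adj _ _).1 ha with ⟨h1, h2⟩ | ⟨h1, h2⟩
        · have := h.dp _ h1; rw [h2] at this; omega
        · have := h.dp _ h1; rw [h2] at this; omega
    obtain ⟨w, hw⟩ := hc.exists_walk_length_eq_dist c u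
    have := this _ _ w
    rw [h.d0] at this
    omega

/-- induction from the leaves -/
lemma RT.indup (h : RT T c p d) {P : V → Prop} (hs : ∀ u, (∀ w ∈ ch c p u, P w) → P u) :
    ∀ u, P u := by
  obtain ⟨N, hN⟩ : ∃ N, ∀ u, d u < N := by
    refine ⟨∑ u, d u + 1, fun u => ?_⟩
    have := Finset.single_le_sum (f := d) (fun _ _ => Nat.zero_le _) (mem_univ u)
    omega
  have : ∀ m u, N ≤ d u + m → P u := by
    intro m
    induction m with
    | zero => intro u hu; have := hN u; omega
    | succ m ih =>
      intro u hu
      refine hs u fun w hw => ih w ?_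
      obtain ⟨h1, h2⟩ := mem_ch.1 hw
      have := h.dp w h1
      rw [h2] at this
      omega
  exact fun u => this N u (by omega)

lemma RT.exF (h : RT T c p d) (a : V → ℕ) : ∃ F : V → ℕ, ∀ u, F u = a u + ∑ w ∈ ch c p u, F w := by
  obtain ⟨N, hN⟩ : ∃ N, ∀ u, d u < N := by
    refine ⟨∑ u, d u + 1, fun u => ?_⟩
    have := Finset.single_le_sum (f := d) (fun _ _ => Nat.zero_le _) (mem_univ u)
    omega
  let G : ℕ → V → ℕ := fun m => Nat.rec (fun _ => 0) (fun _ g u => a u + ∑ w ∈ ch c p u, g w) m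
  have G1 : ∀ m u, G (m+1) u = a u + ∑ w ∈ ch c p u, G m w := fun m u => rfl
  have st : ∀ m u, N ≤ d u + m → G (m+1) u = G m u := by
    intro m
    induction m with
    | zero => intro u hu; have := hN u; omega
    | succ m ih =>
      intro u hu
      rw [G1 (m+1), G1 m]
      congr 1
      refine Finset.sum_congr rfl fun w hw => ih w ?_
      obtain ⟨h1, h2⟩ := mem_ch.1 hw
      have := h.dp w h1
      rw [h2] at this
      omega
  refine ⟨G N, fun u => ?_⟩
  rw [← G1, st N u (by omega)]

lemma total {a F : V → ℕ} (hF : ∀ u, F u = a u + ∑ w ∈ ch c p u, F w) : F c = ∑ u, a u := by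
  have h1 : ∑ u, F u = ∑ u, a u + ∑ u, ∑ w ∈ ch c p u, F w := by
    rw [← Finset.sum_add_distrib]; exact Finset.sum_congr rfl fun u _ => hF u
  rw [sum_ch, ← Finset.add_sum_erase _ _ (mem_univ c)] at h1
  omega

/-! leaf counting -/

lemma RT.leaf_iff (h : RT T c p d) {u : V} (hu : u ≠ c) : gdeg T u = 1 ↔ ch c p u = ∅ := by
  rw [h.gd, if_neg hu]
  constructor
  · intro h1
    exact Finset.card_eq_zero.1 (by omega)
  · intro h1; simp [h1]

lemma RT.exq (h : RT T c p d) : ∃ q : V → ℕ, (∀ u, 1 ≤ q u) ∧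
    (∀ u, (ch c p u).Nonempty → q u = ∑ w ∈ ch c p u, q w) ∧ (∀ u, ch c p u = ∅ → q u = 1) ∧
    (gdeg T c ≠ 1 → (ch c p c).Nonempty → q c = {v : V | gdeg T v = 1}.ncard) ∧
    (gdeg T c = 1 → q c + 1 = {v : V | gdeg T v = 1}.ncard) := by
  classical
  obtain ⟨q, hq⟩ := h.exF (fun u => if ch c p u = ∅ then 1 else 0)
  have hnc : {v : V | gdeg T v = 1}.ncard = (univ.filter fun v => gdeg T v = 1).card := by
    rw [← Set.ncard_coe_finset]; simp
  have htot : q c = (univ.filter fun v => ch c p v = ∅).card := by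
    rw [total hq, Finset.card_filter]
  refine ⟨q, ?_, fun u hu => ?_, fun u hu => ?_, ?_, ?_⟩
  · refine h.indup fun u ih => ?_
    rcases Finset.eq_empty_or_nonempty (ch c p u) with h0 | ⟨w, hw⟩
    · rw [hq, if_pos h0]; omega
    · rw [hq]
      have := Finset.single_le_sum (f := q) (fun _ _ => Nat.zero_le _) hw
      have := ih w hw
      omega
  · rw [hq, if_neg hu.ne_empty, zero_add]
  · rw [hq, if_pos hu, hu]; simp
  · intro hc hne
    rw [hnc, htot]
    congr 1
    ext v
    simp only [mem_filter, mem_univ, true_and]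
    by_cases hv : v = c
    · subst hv; simp [hc, hne.ne_empty]
    · exact (h.leaf_iff hv).symm
  · intro hc
    have hne : ch c p c ≠ ∅ := by
      intro h0
      rw [h.gd] at hc
      simp [h0] at hc
    have : (univ.filter fun v => gdeg T v = 1) = insert c (univ.filter fun v => ch c p v = ∅) := by
      ext v
      simp only [mem_filter, mem_univ, true_and, mem_insert]
      by_cases hv : v = c
      · subst hv; simp [hc]
      · simp [hv, h.leaf_iff hv]
    rw [hnc, htot, this, Finset.card_insert_of_notMem (by simpa using hne)]

end Sp

namespace Sp
set_option linter.unusedSectionVars false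
variable {V : Type*} [Fintype V] [DecidableEq V]
variable {T : SimpleGraph V} {c : V} {p : V → V} {d : V → ℕ}

lemma tangent (a : ℕ → ℝ) (ha : StrictAnti fun n => a (n+1) - a n) (q m : ℕ) :
    a m ≤ a q + ((m:ℝ) - q) * (a (q+1) - a q) ∧
    (m ≠ q → m ≠ q + 1 → a m < a q + ((m:ℝ) - q) * (a (q+1) - a q)) := by
  have up : ∀ j, a (q + 2 + j) < a q + ((2:ℝ) + j) * (a (q+1) - a q) := by
    intro j
    induction j with
    | zero =>
      have := ha (show q < q + 1 by omega)
      simp only at this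
      push_cast
      simp only [add_zero]
      linarith
    | succ j ih =>
      have := ha (show q < q + 2 + j by omega)
      simp only at this
      push_cast
      rw [← add_assoc]
      linarith
  have dn : ∀ j, ∀ q' , q' + 1 + j = q → a q' < a q + ((q':ℝ) - q) * (a (q+1) - a q) := by
    intro j
    induction j with
    | zero =>
      intro q' h
      have h2 := ha (show q' < q by omega)
      simp only at h2
      rw [add_zero] at h
      rw [← h] at h2 ⊢
      push_cast
      linarith
    | succ j ih =>
      intro q' h
      have h1 := ih (q'+1) (by omega)
      have h2 := ha (show q' < q by omega)
      simp only at h2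
      push_cast at h1
      linarith
  have strict : m ≠ q → m ≠ q + 1 → a m < a q + ((m:ℝ) - q) * (a (q+1) - a q) := by
    intro h1 h2
    rcases lt_or_ge m q with h | h
    · exact dn (q - m - 1) m (by omega)
    · obtain ⟨j, rfl⟩ : ∃ j, m = q + 2 + j := ⟨m - q - 2, by omega⟩
      have := up j
      push_cast
      linarith
  refine ⟨?_, strict⟩
  by_cases h1 : m = q
  · subst h1; simp
  by_cases h2 : m = q + 1
  · subst h2; push_cast; linarith
  exact (strict h1 h2).le

/-- comparison of a balanced family with an arbitrary one -/
lemma balance {α β : Type*} (a : ℕ → ℝ) (ha : StrictAnti fun n => a (n+1) - a n)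
    (A : Finset α) (B : Finset β) (l : α → ℕ) (m : β → ℕ) (hcard : A.card = B.card)
    (hsum : ∑ i ∈ A, l i = ∑ i ∈ B, m i) (hbal : ∀ i ∈ A, ∀ j ∈ A, l i ≤ l j + 1) :
    ∑ i ∈ B, a (m i) ≤ ∑ i ∈ A, a (l i) ∧
    (∑ i ∈ B, a (m i) = ∑ i ∈ A, a (l i) → ∀ i ∈ B, ∀ j ∈ B, m i ≤ m j + 1) := by
  rcases A.eq_empty_or_nonempty with hA | hA
  · subst hA
    have : B = ∅ := Finset.card_eq_zero.1 (by simpa using hcard.symm)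
    subst this
    simp
  obtain ⟨i0, hi0, hmin⟩ := Finset.exists_min_image A l hA
  set q := l i0 with hq
  have e1 : ∑ i ∈ A, a (l i) = ∑ i ∈ A, (a q + ((l i:ℝ) - q) * (a (q+1) - a q)) := by
    refine Finset.sum_congr rfl fun i hi => ?_
    have h1 := hmin i hi
    have h2 := hbal i hi i0 hi0
    rcases (show l i = q ∨ l i = q + 1 by omega) with h | h
    · rw [h]; simp
    · rw [h]; push_cast; ring
  have e2 : ∀ {γ : Type _} (S : Finset γ) (l : γ → ℕ), ∑ i ∈ S, (a q + ((l i:ℝ) - q) * (a (q+1) - a q))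
      = S.card * a q + (((∑ i ∈ S, l i : ℕ):ℝ) - S.card * q) * (a (q+1) - a q) := by
    intro γ S l
    rw [Finset.sum_add_distrib, ← Finset.sum_mul, Finset.sum_sub_distrib]
    simp
  have e2' : ∑ i ∈ B, (a q + ((m i:ℝ) - q) * (a (q+1) - a q))
      = B.card * a q + (((∑ i ∈ B, m i : ℕ):ℝ) - B.card * q) * (a (q+1) - a q) := by
    rw [Finset.sum_add_distrib, ← Finset.sum_mul, Finset.sum_sub_distrib]
    simp
  have e3 : ∑ i ∈ A, a (l i) = ∑ i ∈ B, (a q + ((m i:ℝ) - q) * (a (q+1) - a q)) := by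
    rw [e1, e2, e2', hcard, hsum]
  have hle : ∀ i ∈ B, a (m i) ≤ (a q + ((m i:ℝ) - q) * (a (q+1) - a q)) :=
    fun i _ => (tangent a ha q (m i)).1
  rw [e3]
  refine ⟨Finset.sum_le_sum hle, fun he => ?_⟩
  have h4 := (Finset.sum_eq_sum_iff_of_le hle).1 he
  have h5 : ∀ i ∈ B, m i = q ∨ m i = q + 1 := by
    intro i hi
    by_contra hn
    push Not at hn
    have := (tangent a ha q (m i)).2 hn.1 hn.2
    have := h4 i hi
    linarith
  intro i hi j hj
  rcases h5 i hi with h | h <;> rcases h5 j hj with h' | h' <;> omega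

noncomputable def rho (μ : ℝ) : ℕ → ℝ
  | 0 => -1
  | n+1 => (μ - 2 - rho μ n)⁻¹

lemma rho_bd {μ : ℝ} (hμ : 4 ≤ μ) (n : ℕ) : 0 < rho μ (n+1) ∧ rho μ (n+1) < 1 := by
  induction n with
  | zero =>
    simp only [rho]
    constructor
    · apply inv_pos.2; linarith
    · apply inv_lt_one_of_one_lt₀; linarith
  | succ n ih =>
    rw [rho]
    constructor
    · apply inv_pos.2; linarith
    · apply inv_lt_one_of_one_lt₀; linarith

lemma rho_anti {μ : ℝ} (hμ : 4 ≤ μ) : StrictAnti fun n => rho μ (n+1) - rho μ n := by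
  have key : ∀ n, 0 < rho μ (n+1) - rho μ n ∧
      rho μ (n+2) - rho μ (n+1) < rho μ (n+1) - rho μ n ∧ 0 < rho μ (n+2) - rho μ (n+1) := by
    intro n
    induction n with
    | zero =>
      have h1 := rho_bd hμ 0
      have h2 := rho_bd hμ 1
      have h0 : rho μ 0 = -1 := rfl
      simp only [zero_add, h0] at h1 h2 ⊢
      refine ⟨by linarith, by linarith, ?_⟩
      rw [sub_pos]
      show (μ - 2 - rho μ 0)⁻¹ < (μ - 2 - rho μ 1)⁻¹
      rw [h0]
      apply inv_strictAnti₀ <;> linarith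
    | succ n ih =>
      have h1 := rho_bd hμ n
      have h2 := rho_bd hμ (n+1)
      have h3 := rho_bd hμ (n+2)
      have e : rho μ (n+3) - rho μ (n+2) =
          rho μ (n+3) * rho μ (n+2) * (rho μ (n+2) - rho μ (n+1)) := by
        have e1 : rho μ (n+3) = (μ - 2 - rho μ (n+2))⁻¹ := rfl
        have e2 : rho μ (n+2) = (μ - 2 - rho μ (n+1))⁻¹ := rfl
        have n1 : μ - 2 - rho μ (n+2) ≠ 0 := by
          intro h; rw [e1, h] at h3; simp at h3
        have n2 : μ - 2 - rho μ (n+1) ≠ 0 := by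
          intro h; rw [e2, h] at h2; simp at h2
        have f1 : rho μ (n+3) * (μ - 2 - rho μ (n+2)) = 1 := by rw [e1]; exact inv_mul_cancel₀ n1
        have f2 : rho μ (n+2) * (μ - 2 - rho μ (n+1)) = 1 := by
          conv_lhs => rw [e2]
          exact inv_mul_cancel₀ n2
        linear_combination rho μ (n+2) * f1 - rho μ (n+3) * f2
      refine ⟨ih.2.2, ?_, ?_⟩
      · show rho μ (n+3) - rho μ (n+2) < rho μ (n+2) - rho μ (n+1)
        rw [e]
        have : rho μ (n+3) * rho μ (n+2) < 1 := by nlinarith [h3.1, h3.2, h2.1, h2.2]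
        nlinarith [ih.2.2]
      · show 0 < rho μ (n+3) - rho μ (n+2)
        rw [e]
        exact mul_pos (mul_pos h3.1 h2.1) ih.2.2
  exact strictAnti_nat_of_succ_lt fun n => (key n).2.1

lemma RT.lb (h : RT T c p d) (hk : 1 ≤ gdeg T c) (μ : ℝ) (hμ : IsMaxEig T μ) :
    (gdeg T c : ℝ) + 1 ≤ μ := by
  by_contra hn
  push Not at hn
  set k := gdeg T c with hkd
  have hk0 : (0:ℝ) < k := by exact_mod_cast hk
  set r : V → ℝ := fun u => if p u = c then (k:ℝ)⁻¹ else 0 with hr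
  have hrn : ∀ u, 0 ≤ r u := fun u => by
    simp only [hr]; split_ifs
    · exact (inv_pos.2 hk0).le
    · exact le_rfl
  have hcard : (ch c p c).card = k := by rw [hkd, h.gd]; simp
  have := h.lower r μ hμ (by
    intro u hu h0
    have hpc : p u = c := by
      by_contra hne; apply h0; simp [hr, hne]
    have h1 : r u = (k:ℝ)⁻¹ := by simp [hr, hpc]
    have h2 : 1 ≤ gdeg T u := by rw [h.gd, if_neg hu]; omega
    have h3 : (1:ℝ) ≤ gdeg T u := by exact_mod_cast h2
    have h4 : 0 ≤ ∑ w ∈ ch c p u, r w := Finset.sum_nonneg fun w _ => hrn w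
    rw [E, if_neg hu, h1, inv_inv]
    linarith)
  have h5 : ∑ w ∈ ch c p c, r w = 1 := by
    rw [Finset.sum_congr rfl (g := fun _ => (k:ℝ)⁻¹)]
    · rw [Finset.sum_const, hcard, nsmul_eq_mul, mul_inv_cancel₀ hk0.ne']
    · intro w hw
      simp [hr, (mem_ch.1 hw).2]
  rw [E, if_pos rfl, h5] at this
  linarith

lemma RT.nonspider (h : RT T c p d) (k : ℕ) (hk : 4 ≤ k)
    (hl : {v : V | gdeg T v = 1}.ncard = k) (hD : 2 ≤ gdeg T c) (hDk : gdeg T c + 1 ≤ k)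
    (hmax : ∀ u, gdeg T u ≤ gdeg T c) (ν : ℝ) (f : V → ℝ) (hf : f ≠ 0)
    (hν : (lap T).mulVec f = ν • f) : ν < k + 1 := by
  classical
  obtain ⟨q, q1, q2, q3, q4, -⟩ := h.exq
  have hcard : (ch c p c).card = gdeg T c := by rw [h.gd c]; simp
  have hcne : (ch c p c).Nonempty := Finset.card_pos.1 (by omega)
  have hqc : q c = k := by rw [q4 (by omega) hcne, hl]
  set D := gdeg T c with hDdef
  have hkr : (4:ℝ) ≤ k := by exact_mod_cast hk
  set t : ℝ := ((k:ℝ) - 2)⁻¹ with ht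
  have tpos : 0 < t := inv_pos.2 (by linarith)
  have thalf : t ≤ 1/2 := by
    rw [ht, one_div]; apply inv_anti₀ <;> linarith
  set r : V → ℝ := fun u => if q u = 1 then t else 1 with hr
  have rpos : ∀ u, 0 < r u := fun u => by
    simp only [hr]; split_ifs
    · exact tpos
    · exact one_pos
  have rq : ∀ u, r u ≤ (q u : ℝ) / 2 := fun u => by
    simp only [hr]
    split_ifs with hq
    · rw [hq]; push_cast; exact thalf
    · have : 2 ≤ q u := by have := q1 u; omega
      have : (2:ℝ) ≤ q u := by exact_mod_cast this
      linarith
  have sumr : ∀ u, (ch c p u).Nonempty → ∑ w ∈ ch c p u, r w ≤ (q u : ℝ) / 2 := by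
    intro u hu
    rw [q2 u hu]
    push_cast
    rw [Finset.sum_div]
    exact Finset.sum_le_sum fun w _ => rq w
  have qD : ∀ u, u ≠ c → q u + D ≤ k + 1 := by
    refine h.ind (fun hc => absurd rfl hc) fun u hu ih _ => ?_
    have hm : u ∈ ch c p (p u) := mem_ch.2 ⟨hu, rfl⟩
    by_cases hpc : p u = c
    · rw [hpc] at hm
      have h1 := q2 c hcne
      rw [← Finset.add_sum_erase _ _ hm] at h1
      have h2 : ((ch c p c).erase u).card ≤ ∑ w ∈ (ch c p c).erase u, q w := by
        rw [Finset.card_eq_sum_ones]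
        exact Finset.sum_le_sum fun w _ => q1 w
      rw [Finset.card_erase_of_mem hm] at h2
      omega
    · have h1 := ih hpc
      have h2 := q2 (p u) ⟨u, hm⟩
      have := Finset.single_le_sum (f := q) (fun _ _ => Nat.zero_le _) hm
      omega
  have leafE : ∀ u, u ≠ c → ch c p u = ∅ → E T c p r u < k + 1 := by
    intro u hu h0
    have h1 : r u = t := by simp [hr, q3 u h0]
    rw [E, if_neg hu, h1, ht, inv_inv, h0, h.gd, if_neg hu, h0]
    simp; linarith
  have hE : ∀ u, E T c p r u ≤ (k:ℝ) + 1 := by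
    intro u
    by_cases hu : u = c
    · rw [hu]
      obtain ⟨w0, hw0, hqw0⟩ : ∃ w ∈ ch c p c, 2 ≤ q w := by
        by_contra hn
        push Not at hn
        have h1 := q2 c hcne
        rw [Finset.sum_congr rfl (g := fun _ => 1) (fun w hw => by
          have := q1 w; have := hn w hw; omega)] at h1
        rw [← Finset.card_eq_sum_ones] at h1
        omega
      set b : V → ℕ := fun w => if q w = 1 then 1 else 0 with hb
      have ha : ∑ w ∈ ch c p c, b w + 2 ≤ k := by
        rw [← hqc, q2 c hcne, ← Finset.add_sum_erase _ _ hw0, ← Finset.add_sum_erase _ q hw0]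
        have h1 : b w0 = 0 := by simp only [hb]; rw [if_neg (by omega)]
        have h2 : ∑ w ∈ (ch c p c).erase w0, b w ≤ ∑ w ∈ (ch c p c).erase w0, q w := by
          refine Finset.sum_le_sum fun w _ => ?_
          simp only [hb]; split_ifs <;> omega
        omega
      have ha' : (∑ w ∈ ch c p c, (b w : ℝ)) ≤ k - 2 := by
        have : ((∑ w ∈ ch c p c, b w + 2 : ℕ) : ℝ) ≤ k := by exact_mod_cast ha
        push_cast at this
        linarith
      have h3 : ∑ w ∈ ch c p c, (1 + r w) ≤ ∑ w ∈ ch c p c, ((q w : ℝ) + t * b w) := by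
        refine Finset.sum_le_sum fun w _ => ?_
        simp only [hr, hb]
        split_ifs with hq
        · rw [hq]; simp
        · have : 2 ≤ q w := by have := q1 w; omega
          have : (2:ℝ) ≤ q w := by exact_mod_cast this
          push_cast
          linarith
      rw [Finset.sum_add_distrib, Finset.sum_add_distrib, ← Finset.mul_sum] at h3
      have h4 : (∑ w ∈ ch c p c, (q w:ℝ)) = k := by
        rw [← hqc, q2 c hcne]; push_cast; rfl
      have h5 : t * ∑ w ∈ ch c p c, (b w : ℝ) ≤ 1 := by
        calc _ ≤ t * ((k:ℝ) - 2) := mul_le_mul_of_nonneg_left ha' tpos.le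
          _ = 1 := by rw [ht]; exact inv_mul_cancel₀ (by linarith)
      have h6 : (∑ w ∈ ch c p c, (1:ℝ)) = D := by
        rw [Finset.sum_const, hcard]; simp
      rw [E, if_pos rfl]
      linarith
    · rcases Finset.eq_empty_or_nonempty (ch c p u) with h0 | h0
      · exact (leafE u hu h0).le
      have hs := sumr u h0
      by_cases hq : q u = 1
      · have h1 : r u = t := by simp [hr, hq]
        have h2 : (ch c p u).card ≤ 1 := by
          rw [← hq, q2 u h0, Finset.card_eq_sum_ones]
          exact Finset.sum_le_sum fun w _ => q1 w
        have h3 : gdeg T u ≤ 2 := by rw [h.gd, if_neg hu]; omega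
        have h4 : (gdeg T u : ℝ) ≤ 2 := by exact_mod_cast h3
        rw [E, if_neg hu, h1, ht, inv_inv]
        rw [hq] at hs
        push_cast at hs
        linarith
      · have h1 : r u = 1 := by simp [hr, hq]
        have h2 := qD u hu
        have h3 := hmax u
        have h4 : 2 * gdeg T u + q u ≤ 2 * k := by omega
        have h5 : 2 * (gdeg T u : ℝ) + q u ≤ 2 * k := by exact_mod_cast h4
        rw [E, if_neg hu, h1, inv_one]
        linarith
  obtain ⟨h1, h2⟩ := h.upper r rpos (k+1) ν hE f hf hν
  refine lt_of_le_of_ne h1 fun he => ?_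
  obtain ⟨v, hv⟩ : {v : V | gdeg T v = 1}.Nonempty := by
    rw [← Set.ncard_pos]; omega
  have hvc : v ≠ c := by
    rintro rfl
    have : gdeg T v = 1 := hv
    omega
  have := leafE v hvc ((h.leaf_iff hvc).1 hv)
  rw [h2 he] at this
  exact lt_irrefl _ this

end Sp

namespace Sp
set_option linter.unusedSectionVars false
variable {V : Type*} [Fintype V] [DecidableEq V]
variable {T : SimpleGraph V} {c : V} {p : V → V} {d : V → ℕ}

lemma RT.spider (h : RT T c p d) (hs : ∀ v, v ≠ c → gdeg T v ≤ 2) :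
    ∃ l : V → ℕ, (∑ w ∈ ch c p c, l w + 1 = Fintype.card V) ∧
      (∀ μ : ℝ, 4 ≤ μ → ∀ u, 0 < rho μ (l u)) ∧
      (∀ μ : ℝ, 4 ≤ μ → ∀ u, u ≠ c → E T c p (fun v => rho μ (l v)) u = μ) ∧
      (∀ u, u ≠ c → gdeg T u = 1 → ∃ w ∈ ch c p c, l w = d u) ∧
      (∀ w ∈ ch c p c, ∃ u, gdeg T u = 1 ∧ d u = l w) := by
  obtain ⟨l, hl⟩ := h.exF (fun _ => 1)
  have cases : ∀ u, u ≠ c → (ch c p u = ∅ ∧ l u = 1 ∧ gdeg T u = 1) ∨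
      ∃ w, ch c p u = {w} ∧ l u = l w + 1 ∧ gdeg T u = 2 := by
    intro u hu
    have h1 := h.gd u
    have h2 := hs u hu
    rw [if_neg hu] at h1
    rcases (show (ch c p u).card = 0 ∨ (ch c p u).card = 1 by omega) with h0 | h0
    · left
      have := Finset.card_eq_zero.1 h0
      exact ⟨this, by rw [hl, this]; simp, by omega⟩
    · right
      obtain ⟨w, hw⟩ := Finset.card_eq_one.1 h0
      exact ⟨w, hw, by rw [hl, hw, Finset.sum_singleton, add_comm], by omega⟩
  have pos : ∀ u, ∃ m, l u = m + 1 := fun u => ⟨_, by rw [hl u, add_comm]⟩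
  refine ⟨l, ?_, ?_, ?_, ?_, ?_⟩
  · have h1 := total hl
    rw [hl c] at h1
    simp at h1
    omega
  · intro μ hμ u
    obtain ⟨m, hm⟩ := pos u
    rw [hm]; exact (rho_bd hμ m).1
  · intro μ hμ u hu
    rw [E, if_neg hu]
    rcases cases u hu with ⟨h1, h2, h3⟩ | ⟨w, h1, h2, h3⟩
    · rw [h1, h2, h3]; simp [rho]; ring
    · rw [h1, h2, h3]; simp [rho]; ring
  · have : ∀ u, u ≠ c → ∃ w ∈ ch c p c, l w + 1 = l u + d u := by
      refine h.ind (fun hc => absurd rfl hc) fun u hu ih _ => ?_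
      have hm : u ∈ ch c p (p u) := mem_ch.2 ⟨hu, rfl⟩
      have hd := h.dp u hu
      by_cases hpc : p u = c
      · rw [hpc] at hm hd
        rw [h.d0] at hd
        exact ⟨u, hm, by omega⟩
      · obtain ⟨w, hw, he⟩ := ih hpc
        refine ⟨w, hw, ?_⟩
        rcases cases _ hpc with ⟨h1, h2, h3⟩ | ⟨v, h1, h2, h3⟩
        · rw [h1] at hm; simp at hm
        · rw [h1, mem_singleton] at hm
          subst hm
          omega
    intro u hu hg
    obtain ⟨w, hw, he⟩ := this u hu
    refine ⟨w, hw, ?_⟩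
    rcases cases _ hu with ⟨h1, h2, h3⟩ | ⟨v, h1, h2, h3⟩ <;> omega
  · have : ∀ u, u ≠ c → ∃ v, gdeg T v = 1 ∧ d v + 1 = l u + d u := by
      refine h.indup fun u ih hu => ?_
      rcases cases _ hu with ⟨h1, h2, h3⟩ | ⟨v, h1, h2, h3⟩
      · exact ⟨u, h3, by omega⟩
      · have hm : v ∈ ch c p u := by rw [h1]; simp
        obtain ⟨hvc, hpv⟩ := mem_ch.1 hm
        obtain ⟨x, hx, he⟩ := ih v hm hvc
        have := h.dp v hvc
        rw [hpv] at this
        exact ⟨x, hx, by omega⟩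
    intro w hw
    obtain ⟨hwc, hpw⟩ := mem_ch.1 hw
    obtain ⟨v, hv, he⟩ := this w hwc
    have := h.dp w hwc
    rw [hpw, h.d0] at this
    exact ⟨v, hv, by omega⟩

lemma dichot (hT : T.IsTree) (k : ℕ) (hk : 3 ≤ k)
    (hl : {v : V | gdeg T v = 1}.ncard = k) :
    ∃ c : V, 3 ≤ gdeg T c ∧ (∀ u, gdeg T u ≤ gdeg T c) ∧ gdeg T c ≤ k ∧
      (gdeg T c = k → ∀ v, v ≠ c → gdeg T v ≤ 2) := by
  classical
  have := hT.1.nonempty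
  obtain ⟨c, -, hmax⟩ := Finset.exists_max_image univ (fun u => gdeg T u) univ_nonempty
  have hmax : ∀ u, gdeg T u ≤ gdeg T c := fun u => hmax u (mem_univ _)
  obtain ⟨p, h⟩ := RT.of_tree hT c
  obtain ⟨q, q1, q2, q3, q4, q5⟩ := h.exq
  have hcard : (ch c p c).card = gdeg T c := by rw [h.gd c]; simp
  have hD : 3 ≤ gdeg T c := by
    by_contra hn
    push Not at hn
    have hq : ∀ u, u ≠ c → q u ≤ 1 := by
      refine h.indup fun u ih hu => ?_
      rcases Finset.eq_empty_or_nonempty (ch c p u) with h0 | h0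
      · rw [q3 u h0]
      · have h1 := h.gd u
        rw [if_neg hu] at h1
        have h2 := hmax u
        have h3 : (ch c p u).card ≤ 1 := by omega
        rw [q2 u h0]
        refine le_trans (Finset.sum_le_sum (g := fun _ => 1) fun w hw => ih w hw (mem_ch.1 hw).1) ?_
        rw [← Finset.card_eq_sum_ones]; exact h3
    rcases Finset.eq_empty_or_nonempty (ch c p c) with h0 | h0
    · rw [h0] at hcard
      obtain ⟨v, hv⟩ : {v : V | gdeg T v = 1}.Nonempty := by
        rw [← Set.ncard_pos]; omega
      have h1 : gdeg T v = 1 := hv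
      have h2 := hmax v
      simp at hcard
      omega
    · have hqc : q c ≤ gdeg T c := by
        rw [q2 c h0, ← hcard, Finset.card_eq_sum_ones]
        exact Finset.sum_le_sum fun w hw => hq w (mem_ch.1 hw).1
      by_cases h1 : gdeg T c = 1
      · have := q5 h1; omega
      · have := q4 h1 h0; omega
  have hne : (ch c p c).Nonempty := Finset.card_pos.1 (by omega)
  have hqc : q c = k := by rw [q4 (by omega) hne, hl]
  refine ⟨c, hD, hmax, ?_, ?_⟩
  · rw [← hqc, q2 c hne, ← hcard, Finset.card_eq_sum_ones]
    exact Finset.sum_le_sum fun w _ => q1 w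
  · intro hDk
    have h1 : ∀ w ∈ ch c p c, 1 = q w := by
      refine (Finset.sum_eq_sum_iff_of_le fun w _ => q1 w).1 ?_
      rw [← q2 c hne, hqc, ← Finset.card_eq_sum_ones, hcard, hDk]
    have h2 : ∀ u, u ≠ c → q u ≤ 1 := by
      refine h.ind (fun hc => absurd rfl hc) fun u hu ih _ => ?_
      have hm : u ∈ ch c p (p u) := mem_ch.2 ⟨hu, rfl⟩
      by_cases hpc : p u = c
      · rw [hpc] at hm
        exact (h1 u hm).ge
      · have := ih hpc
        rw [q2 _ ⟨u, hm⟩] at this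
        exact (Finset.single_le_sum (f := q) (fun _ _ => Nat.zero_le _) hm).trans this
    intro v hv
    rw [h.gd, if_neg hv]
    rcases Finset.eq_empty_or_nonempty (ch c p v) with h0 | h0
    · simp [h0]
    · have h3 := h2 v hv
      rw [q2 v h0] at h3
      have : (ch c p v).card ≤ ∑ w ∈ ch c p v, q w := by
        rw [Finset.card_eq_sum_ones]; exact Finset.sum_le_sum fun w _ => q1 w
      omega

def Bal (T : SimpleGraph V) (k : ℕ) : Prop :=
  ∃ c : V, gdeg T c = k ∧ (∀ v : V, v ≠ c → gdeg T v ≤ 2) ∧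
          ∀ u w : V, gdeg T u = 1 → gdeg T w = 1 →
            (T.dist c u : ℤ) ≤ (T.dist c w : ℤ) + 1

lemma mainP (k : ℕ) (hk : 3 ≤ k) (S T : SimpleGraph V) (hS : S.IsTree) (hT : T.IsTree)
    (hSb : Bal S k) (hl : {v : V | gdeg T v = 1}.ncard = k) (μ ν : ℝ)
    (hμ : IsMaxEig S μ) (hν : IsMaxEig T ν) : ν ≤ μ ∧ (ν = μ → Bal T k) := by
  obtain ⟨c, hck, hc2, hcb⟩ := hSb
  obtain ⟨p, h⟩ := RT.of_tree hS c
  have hlb := h.lb (by omega) μ hμ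
  rw [hck] at hlb
  have hkr : (3:ℝ) ≤ k := by exact_mod_cast hk
  have h4 : 4 ≤ μ := by linarith
  obtain ⟨f, hf, hfe⟩ := hν.1
  obtain ⟨c', hD, hmax, hDk, hsp⟩ := dichot hT k hk hl
  obtain ⟨p', h'⟩ := RT.of_tree hT c'
  rcases hDk.lt_or_eq with hlt | heq
  · have := h'.nonspider k (by omega) hl (by omega) (by omega) hmax ν f hf hfe
    exact ⟨by linarith, fun he => by linarith⟩
  have hc2' := hsp heq
  obtain ⟨l, l1, l2, l3, l4, l5⟩ := h.spider hc2
  obtain ⟨m, m1, m2, m3, m4, m5⟩ := h'.spider hc2'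
  have hEc := h.lower (fun v => rho μ (l v)) μ hμ (fun u hu _ => (l3 μ h4 u hu).ge)
  have hcard : (ch c p c).card = k := by rw [← hck, h.gd c]; simp
  have hcard' : (ch c' p' c').card = k := by rw [← heq, h'.gd c']; simp
  have hb := balance (rho μ) (rho_anti h4) (ch c p c) (ch c' p' c') l m (by omega) (by omega) (by
    intro i hi j hj
    obtain ⟨u, hu, hdu⟩ := l5 i hi
    obtain ⟨w, hw, hdw⟩ := l5 j hj
    have := hcb u w hu hw
    omega)
  have hEcc : E T c' p' (fun v => rho μ (m v)) c' = k + ∑ w ∈ ch c' p' c', rho μ (m w) := by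
    rw [E, if_pos rfl, heq, add_zero]
  have hEcs : E S c p (fun v => rho μ (l v)) c = k + ∑ w ∈ ch c p c, rho μ (l w) := by
    rw [E, if_pos rfl, hck, add_zero]
  rw [hEcs] at hEc
  obtain ⟨u1, u2⟩ := h'.upper (fun v => rho μ (m v)) (m2 μ h4) μ ν (by
    intro u
    by_cases hu : u = c'
    · rw [hu, hEcc]; linarith [hb.1]
    · exact (m3 μ h4 u hu).le) f hf hfe
  refine ⟨u1, fun he => ⟨c', heq, hc2', ?_⟩⟩
  have h5 := u2 he c'
  rw [hEcc] at h5
  have h6 := hb.2 (by linarith [hb.1])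
  intro u w hu hw
  have ne : ∀ u, gdeg T u = 1 → u ≠ c' := by
    rintro u hu rfl; omega
  obtain ⟨i, hi, hdi⟩ := m4 u (ne u hu) hu
  obtain ⟨j, hj, hdj⟩ := m4 w (ne w hw) hw
  have := h6 i hi j hj
  omega

lemma exS (k : ℕ) (hk : 2 ≤ k) (hkn : k + 1 ≤ Fintype.card V) :
    ∃ S : SimpleGraph V, S.IsTree ∧ {v : V | gdeg S v = 1}.ncard = k ∧ Bal S k := by
  classical
  set n := Fintype.card V with hn
  let e : V ≃ Fin n := Fintype.equivFin V
  let c : V := e.symm ⟨0, by omega⟩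
  let p : V → V := fun v => e.symm ⟨(e v : ℕ) - k, by have := (e v).2; omega⟩
  let d : V → ℕ := fun v => ((e v : ℕ) + (k - 1)) / k
  have ec : (e c : ℕ) = 0 := by simp [c]
  have ep : ∀ v, (e (p v) : ℕ) = (e v : ℕ) - k := fun v => by simp [p]
  have einj : ∀ u v, (e u : ℕ) = e v → u = v := fun u v h => e.injective (Fin.ext h)
  have ene : ∀ v, v ≠ c → 1 ≤ (e v : ℕ) := by
    intro v hv
    by_contra h0
    exact hv (einj _ _ (by omega))
  have esurj : ∀ m, m < n → ∃ v, (e v : ℕ) = m := fun m hm => ⟨e.symm ⟨m, hm⟩, by simp⟩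
  let S : SimpleGraph V :=
    { Adj := fun u v => (u ≠ c ∧ p u = v) ∨ (v ≠ c ∧ p v = u)
      symm := ⟨fun u v h => h.symm⟩
      loopless := ⟨fun u h => by
        have : u ≠ c ∧ p u = u := by tauto
        have h1 := ene u this.1
        have h2 := ep u
        rw [this.2] at h2
        omega⟩ }
  have h : RT S c p d := by
    refine ⟨?_, ?_, fun u v => Iff.rfl⟩
    · simp only [d, ec]
      exact Nat.div_eq_of_lt (by omega)
    · intro u hu
      have h1 := ene u hu
      simp only [d, ep]
      rcases Nat.lt_or_ge (e u : ℕ) k with h2 | h2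
      · rw [Nat.div_eq_of_lt (by omega)]
        have : (e u : ℕ) + (k - 1) = (e u - 1) + k := by omega
        rw [this, Nat.add_div_right _ (by omega), Nat.div_eq_of_lt (by omega)]
      · have : (e u : ℕ) + (k - 1) = (e u - k + (k-1)) + k := by omega
        rw [this, Nat.add_div_right _ (by omega)]
  have chc : (ch c p c).card = k := by
    have : (ch c p c).image (fun v => (e v : ℕ)) = Finset.Icc 1 k := by
      ext m
      simp only [Finset.mem_image, mem_ch, Finset.mem_Icc]
      constructor
      · rintro ⟨v, ⟨h1, h2⟩, rfl⟩
        have := ene v h1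
        have h3 := ep v
        rw [h2, ec] at h3
        omega
      · rintro ⟨h1, h2⟩
        obtain ⟨v, rfl⟩ := esurj m (by omega)
        refine ⟨v, ⟨?_, ?_⟩, rfl⟩
        · rintro rfl; omega
        · apply einj; rw [ep, ec]; omega
    rw [← Finset.card_image_of_injective (f := fun v => (e v : ℕ)) _ (fun u v h => einj u v h),
      this]
    simp
  have gc : gdeg S c = k := by rw [h.gd]; simp [chc]
  have chu : ∀ u, u ≠ c → (ch c p u).card ≤ 1 := by
    intro u hu
    rw [Finset.card_le_one]
    intro a ha b hb
    obtain ⟨a1, a2⟩ := mem_ch.1 ha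
    obtain ⟨b1, b2⟩ := mem_ch.1 hb
    have h1 := ep a
    have h2 := ep b
    rw [a2] at h1; rw [b2] at h2
    have := ene u hu
    exact einj _ _ (by omega)
  have leaf : ∀ u, gdeg S u = 1 ↔ n ≤ (e u : ℕ) + k := by
    intro u
    by_cases hu : u = c
    · subst hu; rw [gc, ec]; omega
    · rw [h.leaf_iff hu]
      have h1 := ene u hu
      constructor
      · intro h0
        by_contra hlt
        obtain ⟨v, hv⟩ := esurj (e u + k) (by omega)
        have : v ∈ ch c p u := by
          refine mem_ch.2 ⟨?_, ?_⟩
          · rintro rfl; omega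
          · apply einj; rw [ep]; omega
        rw [h0] at this
        simp at this
      · intro h0
        rw [Finset.eq_empty_iff_forall_notMem]
        intro v hv
        obtain ⟨v1, v2⟩ := mem_ch.1 hv
        have h3 := ep v
        rw [v2] at h3
        have := (e v).2
        omega
  refine ⟨S, h.isTree, ?_, c, gc, ?_, ?_⟩
  · have : {v : V | gdeg S v = 1} = (univ.filter fun v => n ≤ (e v : ℕ) + k : Finset V) := by
      ext v; simp [leaf]
    rw [this, Set.ncard_coe_finset]
    have : (univ.filter fun v => n ≤ (e v : ℕ) + k : Finset V).image (fun v => (e v : ℕ)) =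
        Finset.Ico (n - k) n := by
      ext m
      simp only [Finset.mem_image, mem_filter, mem_univ, true_and, Finset.mem_Ico]
      constructor
      · rintro ⟨v, h1, rfl⟩
        have := (e v).2
        omega
      · rintro ⟨h1, h2⟩
        obtain ⟨v, rfl⟩ := esurj m (by omega)
        exact ⟨v, by omega, rfl⟩
    rw [← Finset.card_image_of_injective (f := fun v => (e v : ℕ)) _ (fun u v h => einj u v h),
      this]
    simp; omega
  · intro v hv
    rw [h.gd, if_neg hv]
    have := chu v hv
    omega
  · intro u w hu hw
    rw [h.dist_eq, h.dist_eq]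
    rw [leaf] at hu hw
    have hu2 := (e u).2
    have : d u ≤ d w + 1 := by
      simp only [d]
      rw [← Nat.add_div_right _ (by omega)]
      exact Nat.div_le_div_right (by omega)
    exact_mod_cast this

end Sp

namespace Sp
set_option linter.unusedSectionVars false
variable {V : Type*} [Fintype V] [DecidableEq V]
variable {T : SimpleGraph V} {c : V} {p : V → V} {d : V → ℕ}

lemma path2 (hT : T.IsTree) (hl : {v : V | gdeg T v = 1}.ncard = 2) :
    ∃ (c : V) (p : V → V), RT T c p (T.dist c) ∧ gdeg T c = 1 ∧ (∀ u, (ch c p u).card ≤ 1) ∧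
      Function.Injective (T.dist c) ∧ (∀ u, T.dist c u < Fintype.card V) ∧
      ∀ u v, T.Adj u v ↔ T.dist c u + 1 = T.dist c v ∨ T.dist c v + 1 = T.dist c u := by
  classical
  obtain ⟨c, hc⟩ : {v : V | gdeg T v = 1}.Nonempty := by
    rw [← Set.ncard_pos]; omega
  have hc : gdeg T c = 1 := hc
  obtain ⟨p, h⟩ := RT.of_tree hT c
  obtain ⟨q, q1, q2, q3, q4, q5⟩ := h.exq
  have hqc : q c = 1 := by have := q5 hc; omega
  have hq : ∀ u, q u ≤ 1 := by
    refine h.ind hqc.le fun u hu ih => ?_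
    have hm : u ∈ ch c p (p u) := mem_ch.2 ⟨hu, rfl⟩
    rw [q2 _ ⟨u, hm⟩] at ih
    exact (Finset.single_le_sum (f := q) (fun _ _ => Nat.zero_le _) hm).trans ih
  have hch : ∀ u, (ch c p u).card ≤ 1 := by
    intro v
    rcases Finset.eq_empty_or_nonempty (ch c p v) with h0 | h0
    · simp [h0]
    · have h3 := hq v
      rw [q2 v h0] at h3
      have : (ch c p v).card ≤ ∑ w ∈ ch c p v, q w := by
        rw [Finset.card_eq_sum_ones]; exact Finset.sum_le_sum fun w _ => q1 w
      omega
  have hinj : ∀ u v, T.dist c u = T.dist c v → u = v := by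
    refine h.ind ?_ ?_
    · intro v hv
      by_contra hne
      have := h.dpos (fun e => hne e.symm : v ≠ c)
      have := h.d0
      omega
    · intro u hu ih v hv
      have hvc : v ≠ c := by
        rintro rfl
        have := h.dpos hu
        have := h.d0
        omega
      have h1 := h.dp u hu
      have h2 := h.dp v hvc
      have h3 := ih (p v) (by omega)
      exact Finset.card_le_one.1 (hch (p u)) u (mem_ch.2 ⟨hu, rfl⟩) v (mem_ch.2 ⟨hvc, h3.symm⟩)
  have himg : ∀ u m, m ≤ T.dist c u → ∃ v, T.dist c v = m := by
    refine h.ind ?_ ?_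
    · intro m hm
      have := h.d0
      exact ⟨c, by omega⟩
    · intro u hu ih m hm
      have h1 := h.dp u hu
      rcases hm.lt_or_eq with h2 | h2
      · exact ih m (by omega)
      · exact ⟨u, h2.symm⟩
  refine ⟨c, p, h, hc, hch, fun u v => hinj u v, ?_, ?_⟩
  · intro u
    have : Finset.range (T.dist c u + 1) ⊆ univ.image (T.dist c) := by
      intro m hm
      obtain ⟨v, hv⟩ := himg u m (by simpa [Nat.lt_succ_iff] using hm)
      exact Finset.mem_image.2 ⟨v, mem_univ _, hv⟩
    have h1 := Finset.card_le_card this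
    have h2 := Finset.card_image_le (s := (univ : Finset V)) (f := T.dist c)
    rw [Finset.card_range] at h1
    rw [Finset.card_univ] at h2
    omega
  · intro u v
    have key : ∀ u v, T.dist c u + 1 = T.dist c v → v ≠ c ∧ p v = u := by
      intro u v he
      have hv : v ≠ c := by
        rintro rfl
        have := h.d0
        omega
      exact ⟨hv, hinj _ _ (by have := h.dp v hv; omega)⟩
    rw [h.adj]
    constructor
    · rintro (⟨h1, rfl⟩ | ⟨h1, rfl⟩)
      · right; exact h.dp _ h1
      · left; exact h.dp _ h1
    · rintro (h1 | h1)
      · right; exact key _ _ h1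
      · left; exact key _ _ h1

lemma path_equiv (hT : T.IsTree) (hl : {v : V | gdeg T v = 1}.ncard = 2) :
    ∃ e : V ≃ Fin (Fintype.card V), ∀ u v, T.Adj u v ↔
      (e u : ℕ) + 1 = e v ∨ (e v : ℕ) + 1 = e u := by
  obtain ⟨c, p, h, -, -, hinj, hlt, hadj⟩ := path2 hT hl
  have hb : Function.Bijective (fun u => (⟨T.dist c u, hlt u⟩ : Fin (Fintype.card V))) := by
    rw [Fintype.bijective_iff_injective_and_card]
    exact ⟨fun u v huv => hinj (by simpa using huv), by simp⟩
  exact ⟨Equiv.ofBijective _ hb, fun u v => hadj u v⟩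

lemma iso_eig (T T' : SimpleGraph V) (e : V ≃ V) (he : ∀ u v, T.Adj (e u) (e v) ↔ T'.Adj u v)
    (μ : ℝ) (f : V → ℝ) (hf : f ≠ 0) (hμ : (lap T).mulVec f = μ • f) :
    ∃ g : V → ℝ, g ≠ 0 ∧ (lap T').mulVec g = μ • g := by
  have hdeg : ∀ u, gdeg T (e u) = gdeg T' u := by
    intro u
    unfold gdeg
    rw [← Set.ncard_image_of_injective (T'.neighborSet u) e.injective]
    congr 1
    ext v
    simp only [mem_neighborSet, Set.mem_image]
    constructor
    · intro h
      exact ⟨e.symm v, by rw [← he]; simpa using h, by simp⟩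
    · rintro ⟨w, hw, rfl⟩
      exact (he _ _).2 hw
  refine ⟨f ∘ e, ?_, ?_⟩
  · intro h0
    apply hf
    funext v
    have := congrFun h0 (e.symm v)
    simpa using this
  · funext u
    have h1 := congrFun hμ (e u)
    simp only [Pi.smul_apply, Function.comp] at h1 ⊢
    rw [← h1]
    simp only [Matrix.mulVec, dotProduct]
    rw [← Equiv.sum_comp e (fun v => lap T (e u) v * f v)]
    refine Finset.sum_congr rfl fun v _ => ?_
    simp only [lap, Matrix.of_apply, hdeg, e.injective.eq_iff, Function.comp]
    have h2 := he u v
    by_cases ha : T'.Adj u v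
    · rw [if_pos ha, if_pos (h2.2 ha)]
    · rw [if_neg ha, if_neg (fun h3 => ha (h2.1 h3))]

lemma path_le (T T' : SimpleGraph V) (hT : T.IsTree) (hT' : T'.IsTree)
    (hl : {v : V | gdeg T v = 1}.ncard = 2) (hl' : {v : V | gdeg T' v = 1}.ncard = 2)
    (μ μ' : ℝ) (h : IsMaxEig T μ) (h' : IsMaxEig T' μ') : μ' ≤ μ := by
  obtain ⟨e, he⟩ := path_equiv hT hl
  obtain ⟨e', he'⟩ := path_equiv hT' hl'
  obtain ⟨f, hf, hfe⟩ := h'.1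
  exact h.2 (iso_eig T' T (e.trans e'.symm) (fun u v => by rw [he, he']; simp) μ' f hf hfe)

lemma path_bal (hT : T.IsTree) (hl : {v : V | gdeg T v = 1}.ncard = 2)
    (hn : 3 ≤ Fintype.card V) : Bal T 2 := by
  obtain ⟨c, p, h, hc, hch, hinj, hlt, hadj⟩ := path2 hT hl
  set n := Fintype.card V with hnd
  have hsurj : ∀ m, m < n → ∃ v, T.dist c v = m := by
    intro m hm
    have hb : Function.Bijective (fun u => (⟨T.dist c u, hlt u⟩ : Fin n)) := by
      rw [Fintype.bijective_iff_injective_and_card]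
      exact ⟨fun u v huv => hinj (by simpa using huv), by simp [hnd]⟩
    obtain ⟨v, hv⟩ := hb.2 ⟨m, hm⟩
    exact ⟨v, by simpa using hv⟩
  have hkid : ∀ u, T.dist c u + 1 < n → (ch c p u).Nonempty := by
    intro u hu
    obtain ⟨v, hv⟩ := hsurj _ hu
    have hvc : v ≠ c := by
      rintro rfl
      have := h.d0
      omega
    exact ⟨v, mem_ch.2 ⟨hvc, hinj (by have := h.dp v hvc; omega)⟩⟩
  obtain ⟨m, hm⟩ := hsurj (n / 2) (by omega)
  have hmc : m ≠ c := by
    rintro rfl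
    have := h.d0
    omega
  have hle : ∀ u, T.dist c m ≤ T.dist c u → T.dist m u + T.dist c m ≤ T.dist c u := by
    refine h.ind ?_ ?_
    · intro h1
      have := h.d0
      omega
    · intro u hu ih h1
      rcases h1.lt_or_eq with h2 | h2
      · have h3 := h.dp u hu
        have h4 := ih (by omega)
        have h5 := hT.1.dist_triangle (u := m) (v := p u) (w := u)
        have h6 : T.dist (p u) u = 1 := dist_eq_one_iff_adj.2 (h.adjp hu).symm
        omega
      · have := hinj h2
        subst this
        simp
  have hleaf : ∀ u, gdeg T u = 1 → T.dist m u ≤ n / 2 ∧ n ≤ T.dist m u + n / 2 + 1 := by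
    intro u hu
    by_cases huc : u = c
    · subst huc
      rw [dist_comm, hm]; omega
    · have h1 := (h.leaf_iff huc).1 hu
      have h2 : ¬ (T.dist c u + 1 < n) := fun h3 => by
        have := hkid u h3
        rw [h1] at this
        simp at this
      have h3 := hlt u
      have h4 := hle u (by omega)
      have h5 := hT.1.dist_triangle (u := c) (v := m) (w := u)
      omega
  refine ⟨m, ?_, ?_, ?_⟩
  · have h1 := hch m
    have h2 := Finset.card_pos.2 (hkid m (by omega))
    rw [h.gd, if_neg hmc]
    omega
  · intro v _
    have h1 := hch v
    rw [h.gd]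
    split_ifs <;> omega
  · intro u w hu hw
    have h1 := hleaf u hu
    have h2 := hleaf w hw
    omega

end Sp

/-- Among trees on `n` vertices with exactly `k` leaves (`2 ≤ k ≤ n-1`), a tree
maximizes the largest Laplacian eigenvalue iff it is a spider: a center `c` of
degree `k`, all other vertices of degree at most `2`, whose leg lengths
(distances from `c` to the leaves) pairwise differ by at most one. -/
theorem stmt15 {V : Type*} [Fintype V] [DecidableEq V] (n k : ℕ)
    (hcard : Fintype.card V = n) (hk2 : 2 ≤ k) (hkn : k ≤ n - 1)
    (T : SimpleGraph V) (hT : T.IsTree)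
    (hleaves : {v : V | gdeg T v = 1}.ncard = k)
    (lam : ℝ) (hlam : IsMaxEig T lam) :
    (∀ T'' : SimpleGraph V, T''.IsTree → {v : V | gdeg T'' v = 1}.ncard = k →
        ∀ lam'' : ℝ, IsMaxEig T'' lam'' → lam'' ≤ lam)
      ↔ ∃ c : V, gdeg T c = k ∧ (∀ v : V, v ≠ c → gdeg T v ≤ 2) ∧
          ∀ u w : V, gdeg T u = 1 → gdeg T w = 1 →
            (T.dist c u : ℤ) ≤ (T.dist c w : ℤ) + 1 := by
  have : Nonempty V := hT.1.nonempty
  have hk1 : k + 1 ≤ Fintype.card V := by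
    have : 0 < Fintype.card V := Fintype.card_pos
    omega
  change _ ↔ Sp.Bal T k
  rcases hk2.lt_or_eq with hk3 | hk3
  · constructor
    · intro hmax
      obtain ⟨S, hS, hSl, hSb⟩ := Sp.exS (V := V) k hk2 hk1
      obtain ⟨μ, hμ⟩ := Sp.exists_max S
      have h1 := Sp.mainP k hk3 S T hS hT hSb hleaves μ lam hμ hlam
      exact h1.2 (le_antisymm h1.1 (hmax S hS hSl μ hμ))
    · intro hb T'' hT'' hl'' lam'' hlam''
      exact (Sp.mainP k hk3 T T'' hT hT'' hb hl'' lam lam'' hlam hlam'').1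
  · subst hk3
    constructor
    · intro _
      exact Sp.path_bal hT hleaves (by omega)
    · intro _ T'' hT'' hl'' lam'' hlam''
      exact Sp.path_le T T'' hT hT'' hleaves hl'' lam lam'' hlam hlam''
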